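/- Let E be the 2×2 complex matrix with entry 1 in position (0,1) and 0 elsewhere, and for 2×2 complex matrices a, b, c define D(a, b, c) = E·(a·b·c) − (a·b·c)·E (the commutator [E, abc]). Then for all 2×2 complex matrices a, b, c, d whose second (bottom) row is zero, the following three identities hold: D(a·d, b, c) = D(a, b, c)·d + a·D(d, b, c); D(a, b·d, c) = D(a, b, c)·d + b·D(a, d, c); D(a, b, c·d) = D(a, b, c)·d + c·D(a, b, d). -/

import Mathlib

noncomputable section

/-- The matrix `E = !![0, 1; 0, 0]`. -/
def Emat : Matrix (Fin 2) (Fin 2) ℂ := !![0, 1; 0, 0]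

/-- `D(a, b, c) = [E, abc] = E·(abc) − (abc)·E`. -/
def Dmat (a b c : Matrix (Fin 2) (Fin 2) ℂ) : Matrix (Fin 2) (Fin 2) ℂ :=
  Emat * (a * b * c) - (a * b * c) * Emat

theorem Emat_mul_eq_zero {d : Matrix (Fin 2) (Fin 2) ℂ} (hd : ∀ j, d 1 j = 0) :
    Emat * d = 0 := by
  ext i j
  fin_cases i <;> simp [Emat, Matrix.mul_apply, Fin.sum_univ_two, hd]

theorem mul_Emat_eq_smul {a : Matrix (Fin 2) (Fin 2) ℂ} (ha : ∀ j, a 1 j = 0) :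
    a * Emat = a 0 0 • Emat := by
  ext i j
  fin_cases i <;> fin_cases j <;> simp [Emat, Matrix.mul_apply, Fin.sum_univ_two, ha]

theorem mul_bottom_row_eq_zero {a : Matrix (Fin 2) (Fin 2) ℂ} (ha : ∀ j, a 1 j = 0)
    (d : Matrix (Fin 2) (Fin 2) ℂ) (j : Fin 2) : (a * d) 1 j = 0 := by
  simp [Matrix.mul_apply, ha]

theorem mul_apply_zero_zero (a : Matrix (Fin 2) (Fin 2) ℂ) {d : Matrix (Fin 2) (Fin 2) ℂ}
    (hd : ∀ j, d 1 j = 0) : (a * d) 0 0 = a 0 0 * d 0 0 := by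
  simp [Matrix.mul_apply, Fin.sum_univ_two, hd]

theorem Dmat_eq_smul {a b c : Matrix (Fin 2) (Fin 2) ℂ}
    (ha : ∀ j, a 1 j = 0) (hb : ∀ j, b 1 j = 0) (hc : ∀ j, c 1 j = 0) :
    Dmat a b c = -(a 0 0 * b 0 0 * c 0 0) • Emat := by
  have habc := mul_bottom_row_eq_zero (mul_bottom_row_eq_zero ha b) c
  rw [Dmat, Emat_mul_eq_zero habc, mul_Emat_eq_smul habc, mul_apply_zero_zero _ hc,
    mul_apply_zero_zero _ hb, zero_sub, neg_smul]

/-- for all 2×2 complex matrices `a, b, c, d` whose bottom row is zero,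
`D` satisfies the three tri-derivation identities. -/
theorem statement18 (a b c d : Matrix (Fin 2) (Fin 2) ℂ)
    (ha : ∀ j, a 1 j = 0) (hb : ∀ j, b 1 j = 0)
    (hc : ∀ j, c 1 j = 0) (hd : ∀ j, d 1 j = 0) :
    Dmat (a * d) b c = Dmat a b c * d + a * Dmat d b c ∧
    Dmat a (b * d) c = Dmat a b c * d + b * Dmat a d c ∧
    Dmat a b (c * d) = Dmat a b c * d + c * Dmat a b d := by
  rw [Dmat_eq_smul (mul_bottom_row_eq_zero ha d) hb hc,
    Dmat_eq_smul ha (mul_bottom_row_eq_zero hb d) hc,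
    Dmat_eq_smul ha hb (mul_bottom_row_eq_zero hc d),
    Dmat_eq_smul ha hb hc, Dmat_eq_smul hd hb hc, Dmat_eq_smul ha hd hc, Dmat_eq_smul ha hb hd]
  simp only [mul_apply_zero_zero _ hd, smul_mul_assoc, mul_smul_comm, Emat_mul_eq_zero hd,
    mul_Emat_eq_smul ha, mul_Emat_eq_smul hb, mul_Emat_eq_smul hc, smul_zero, zero_add, smul_smul]
  refine ⟨?_, ?_, ?_⟩ <;> congr 1 <;> ring
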